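/- arXiv:2304.09456 — 3 statements merged into one kernel-verified Lean document; each statement's English description precedes it below -/
import Mathlib

section
/- Special soundness of the Chaum–Pedersen sigma protocol: Let q be a prime and assume every element of G satisfies a^q = 1. Let X, Y, A, B : G and e, e', z, z' : ℤ with ¬((q : ℤ) ∣ e - e'). If both transcripts are accepting, i.e., A * X^e = g^z, B * Y^e = h^z, A * X^(e') = g^(z'), and B * Y^(e') = h^(z'), then there exists x : ℤ such that X = g^x and Y = h^x; in particular X and Y have equal discrete logarithms with respect to g and h. -/
theorem zpow_sub_eq_of_accepting {G : Type*} [CommGroup G] {g X A : G} {e e' z z' : ℤ}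
    (h : A * X ^ e = g ^ z) (h' : A * X ^ e' = g ^ z') : X ^ (e - e') = g ^ (z - z') := by
  rw [zpow_sub, zpow_sub, ← h, ← h', mul_inv_rev, mul_comm (X ^ e')⁻¹, mul_mul_mul_comm,
    mul_inv_cancel, one_mul]

theorem eq_zpow_of_zpow_eq {G : Type*} [Group G] {g X : G} {q : ℕ} {u v d w : ℤ}
    (hX : X ^ q = 1) (huv : u * q + v * d = 1) (h : X ^ d = g ^ w) : X = g ^ (w * v) := by
  calc
    X = X ^ (u * q + v * d) := by rw [huv, zpow_one]
    _ = g ^ (w * v) := by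
      rw [zpow_add, mul_comm u, mul_comm v, zpow_mul, zpow_mul, zpow_natCast, hX, one_zpow,
        one_mul, h, zpow_mul]

/-- Special soundness of the Chaum–Pedersen sigma protocol: from two accepting
transcripts with the same commitment and distinct challenges (mod the prime
exponent q of the group), the witness exists: X and Y have equal discrete
logarithms with respect to g and h. -/
theorem chaum_pedersen_special_soundness
    {G : Type*} [CommGroup G] (g h : G) (q : ℕ) (hq : q.Prime)
    (hexp : ∀ a : G, a ^ q = 1)
    (X Y A B : G) (e e' z z' : ℤ)
    (hne : ¬ ((q : ℤ) ∣ e - e'))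
    (h1 : A * X ^ e = g ^ z) (h2 : B * Y ^ e = h ^ z)
    (h3 : A * X ^ e' = g ^ z') (h4 : B * Y ^ e' = h ^ z') :
    ∃ x : ℤ, X = g ^ x ∧ Y = h ^ x := by
  obtain ⟨u, v, huv⟩ := (Nat.prime_iff_prime_int.mp hq).irreducible.coprime_iff_not_dvd.mpr hne
  exact ⟨(z - z') * v, eq_zpow_of_zpow_eq (hexp X) huv (zpow_sub_eq_of_accepting h1 h3),
    eq_zpow_of_zpow_eq (hexp Y) huv (zpow_sub_eq_of_accepting h2 h4)⟩
end

section
/- Full soundness of the cast-as-intended proof π_Enc from special soundness (Theorem 1, soundness, fully instantiated): Let q be a prime and assume every element of G satisfies a^q = 1. Let u, w, u*, w*, v, A, B : G and r*, e, e', z, z' : ℤ, and set X = u* * u⁻¹ and Y = w* * w⁻¹. Suppose ¬((q : ℤ) ∣ e - e'), suppose both Chaum–Pedersen transcripts are accepting, i.e., A * X^e = g^z, B * Y^e = h^z, A * X^(e') = g^(z'), B * Y^(e') = h^(z'), and suppose special decryption of (u*, w*) with r* returns v, i.e., u* = g^(r*) and w* = v * h^(r*). Then there exists r' : ℤ with u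 = g^(r') and w = v * h^(r'); that is, the cast ciphertext (u, w) is an ElGamal encryption of the vote v shown to the voter. -/
/-- Special soundness of the Schnorr relation: two accepting transcripts with the same
commitment and challenges differing by an invertible amount determine a discrete logarithm. -/
theorem eq_zpow_of_accepting_transcripts {G : Type*} [CommGroup G] {q : ℕ}
    {g X A : G} {e e' z z' a b : ℤ} (hX : X ^ q = 1) (hab : a * (e - e') + b * q = 1)
    (h : A * X ^ e = g ^ z) (h' : A * X ^ e' = g ^ z') :
    X = g ^ (a * (z - z')) := by
  have hdiff : X ^ (e - e') = g ^ (z - z') := by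
    rw [zpow_sub, zpow_sub, ← h, ← h', ← div_eq_mul_inv, ← div_eq_mul_inv,
      mul_div_mul_left_eq_div]
  calc X = X ^ (a * (e - e') + b * q) := by rw [hab, zpow_one]
    _ = g ^ (a * (z - z')) := by
      rw [zpow_add, mul_comm a, mul_comm b, zpow_mul, zpow_mul, zpow_natCast, hX, one_zpow,
        mul_one, hdiff, ← zpow_mul, mul_comm]

/-- Full soundness of the cast-as-intended proof π_Enc from special soundness
(Theorem 1, soundness, fully instantiated): the cast ciphertext (u, w) is an
ElGamal encryption of the vote v shown to the voter. -/
theorem cast_as_intended_full_soundness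
    {G : Type*} [CommGroup G] (g h : G) (q : ℕ) (hq : q.Prime)
    (hexp : ∀ a : G, a ^ q = 1)
    (u w ustar wstar v A B : G) (rstar e e' z z' : ℤ)
    (X Y : G) (hX : X = ustar * u⁻¹) (hY : Y = wstar * w⁻¹)
    (hne : ¬ ((q : ℤ) ∣ e - e'))
    (h1 : A * X ^ e = g ^ z) (h2 : B * Y ^ e = h ^ z)
    (h3 : A * X ^ e' = g ^ z') (h4 : B * Y ^ e' = h ^ z')
    (hdec1 : ustar = g ^ rstar) (hdec2 : wstar = v * h ^ rstar) :
    ∃ r' : ℤ, u = g ^ r' ∧ w = v * h ^ r' := by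
  obtain ⟨b, a, hab⟩ : IsCoprime (q : ℤ) (e - e') :=
    (Nat.prime_iff_prime_int.mp hq).coprime_iff_not_dvd.mpr hne
  rw [add_comm] at hab
  have hXg := eq_zpow_of_accepting_transcripts (hexp X) hab h1 h3
  have hYh := eq_zpow_of_accepting_transcripts (hexp Y) hab h2 h4
  refine ⟨rstar - a * (z - z'), ?_, ?_⟩
  · rw [zpow_sub, ← hXg, ← hdec1, hX]
    simp
  · rw [zpow_sub, ← hYh, ← mul_assoc, ← hdec2, hY]
    simp
end

section
/- Perfect zero-knowledge simulation of the audit transcript (r*, c*) (Theorem 1, zero-knowledge part, instantiated): Let q be a prime, let g, h, v : G satisfy g^q = 1 and h^q = 1, and fix r : ZMod q. Then the distribution of the real transcript, obtained by choosing the blinding factor x uniformly in ZMod q and outputting (x + r, g^(r.val) * g^(x.val), v * h^(r.val) * h^(x.val)) (the blinded randomness together with the re-randomization of Enc(v; r)), equals the distribution of the simulated transcript, obtained by choosing s uniformly in ZMod q and outputting (s, g^(s.val), v * h^(s.val)) (a fresh encryption of v with uniform randomness). Formally: PMF.map (fun x : ZMod q => (x + r, g^(r.val) * g^(x.val), v *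 h^(r.val) * h^(x.val))) (PMF.uniformOfFintype (ZMod q)) = PMF.map (fun s : ZMod q => (s, g^(s.val), v * h^(s.val))) (PMF.uniformOfFintype (ZMod q)). -/
/-- The uniform distribution on a finite type is invariant under permutations. -/
theorem PMF.map_equiv_uniformOfFintype {α : Type*} [Fintype α] [Nonempty α] (e : α ≃ α) :
    (PMF.uniformOfFintype α).map e = PMF.uniformOfFintype α := by
  classical
  ext a
  rw [PMF.map_apply, tsum_eq_single (e.symm a)]
  · simp
  · intro b hb
    rw [if_neg]
    rintro rfl
    simp at hb

/-- Powers of an element of exponent `n`, indexed by representatives in `ZMod n`, turn addition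
into multiplication. -/
theorem pow_zmod_val_add {M : Type*} [Monoid M] {n : ℕ} [NeZero n] {a : M} (ha : a ^ n = 1)
    (x y : ZMod n) : a ^ (x + y).val = a ^ x.val * a ^ y.val := by
  rw [ZMod.val_add, ← pow_eq_pow_mod _ ha, pow_add]

/-- Perfect zero-knowledge simulation of the audit transcript (r*, c*)
(Theorem 1, zero-knowledge part, instantiated): the real transcript
(blinded randomness together with the re-randomization of Enc(v; r)) is
distributed exactly as the simulated transcript (a fresh encryption of v
with uniform randomness). -/
theorem audit_transcript_perfect_zero_knowledge
    {G : Type*} [CommGroup G] (q : ℕ) (hq : q.Prime) [Fact q.Prime]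
    (g h v : G) (hg : g ^ q = 1) (hh : h ^ q = 1) (r : ZMod q) :
    PMF.map (fun x : ZMod q =>
        (x + r, g ^ (r.val) * g ^ (x.val), v * h ^ (r.val) * h ^ (x.val)))
      (PMF.uniformOfFintype (ZMod q)) =
    PMF.map (fun s : ZMod q => (s, g ^ (s.val), v * h ^ (s.val)))
      (PMF.uniformOfFintype (ZMod q)) := by
  conv_rhs => rw [← PMF.map_equiv_uniformOfFintype (Equiv.addRight r), PMF.map_comp]
  congr 1
  funext x
  simp only [Function.comp_apply, Equiv.coe_addRight, add_comm x r, pow_zmod_val_add hg,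
    pow_zmod_val_add hh, mul_assoc]
end
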